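/- arXiv:2306.12009 — 4 statements merged into one kernel-verified Lean document; each statement's English description precedes it below -/
import Mathlib

section
/- Let λ be a nonzero real number, let r ≥ 1 and n ≥ 1 be integers, and let y be a real number with |y| < 1. Then the series Σ_{k=0}^∞ (k)_{n,λ} · (H^{(r)}_{k,λ} + binom(r+k−1, k)·log_λ(1−y)) · y^k converges absolutely, and (1/(1−y)^r) · HF^{(r)}_{n,λ}(y/(1−y)) = (1−y)^{−λ} · Σ_{k=0}^∞ (k)_{n,λ} · (H^{(r)}_{k,λ} + binom(r+k−1, k)·log_λ(1−y)) · y^k, where log_λ(1−y) = ((1−y)^λ − 1)/λ. -/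
open Finset

/-- The degenerate falling factorial `(x)_{n,λ} = x(x-λ)⋯(x-(n-1)λ)`. -/
noncomputable def degFall (lam x : ℝ) (n : ℕ) : ℝ := ∏ i ∈ Finset.range n, (x - (i : ℝ) * lam)

/-- The ordinary falling factorial `(x)_n = x(x-1)⋯(x-n+1)`. -/
noncomputable def fall (x : ℝ) (n : ℕ) : ℝ := ∏ i ∈ Finset.range n, (x - (i : ℝ))

/-- The rising factorial `⟨a⟩_k = a(a+1)⋯(a+k-1)`. -/
noncomputable def rising (a : ℝ) (k : ℕ) : ℝ := ∏ i ∈ Finset.range k, (a + (i : ℝ))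

/-- The generalized binomial coefficient `binom(a,k) = a(a-1)⋯(a-k+1)/k!`. -/
noncomputable def rchoose (a : ℝ) (k : ℕ) : ℝ :=
  (∏ i ∈ Finset.range k, (a - (i : ℝ))) / (k.factorial : ℝ)

/-- The degenerate harmonic numbers `H_{n,λ} = Σ_{k=1}^n (1/k)·binom(k-1-λ, k-1)`. -/
noncomputable def degH (lam : ℝ) (n : ℕ) : ℝ :=
  ∑ k ∈ Finset.Icc 1 n, (1 / (k : ℝ)) * rchoose ((k : ℝ) - 1 - lam) (k - 1)

/-- The degenerate hyperharmonic numbers `H^{(r)}_{n,λ}`. -/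
noncomputable def degHyperH (lam : ℝ) : ℕ → ℕ → ℝ
  | 0, _ => 0
  | 1, n => degH lam n
  | r + 2, n => ∑ k ∈ Finset.Icc 1 n, degHyperH lam (r + 1) k

/-- The degenerate harmonic-Fubini polynomial built from degenerate Stirling numbers `S2`. -/
noncomputable def HFpoly (lam : ℝ) (S2 : ℕ → ℕ → ℝ) (n : ℕ) (x : ℝ) : ℝ :=
  ∑ k ∈ Finset.Icc 1 n, S2 n k * degH lam k * (k.factorial : ℝ) * x ^ k

/-- The degenerate Fubini polynomial of order `1-λ` built from degenerate Stirling numbers `S2`. -/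
noncomputable def Fpoly (lam : ℝ) (S2 : ℕ → ℕ → ℝ) (n : ℕ) (x : ℝ) : ℝ :=
  ∑ k ∈ Finset.range (n + 1), rising (1 - lam) k * S2 n k * x ^ k

/-- The degenerate hyperharmonic-Fubini polynomial built from degenerate Stirling numbers `S2`. -/
noncomputable def HFpolyR (lam : ℝ) (S2 : ℕ → ℕ → ℝ) (r n : ℕ) (y : ℝ) : ℝ :=
  ∑ k ∈ Finset.Icc 1 n, S2 n k * degHyperH lam r k * (k.factorial : ℝ) * y ^ k

/-- The degenerate falling factorial power of the operator `θ = x·d/dx`: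
`(θ)_{k,λ} = (θ - (k-1)λ) ∘ ⋯ ∘ (θ - λ) ∘ θ`. -/
noncomputable def thetaFall (lam : ℝ) : ℕ → (ℝ → ℝ) → ℝ → ℝ
  | 0, g => g
  | k + 1, g => fun x => x * deriv (thetaFall lam k g) x - (k : ℝ) * lam * thetaFall lam k g x

/-- The family `degHyperH lam r`, extended to `r = 0` by the summands of `degH lam`. -/
noncomputable def degHyperHExt (lam : ℝ) : ℕ → ℕ → ℝ
  | 0, k => if k = 0 then 0 else -(rising (-lam) k / (lam * k.factorial))
  | r + 1, k => degHyperH lam (r + 1) k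

theorem rising_succ (a : ℝ) (k : ℕ) : rising a (k + 1) = rising a k * (a + k) :=
  Finset.prod_range_succ _ _

theorem rising_add (a : ℝ) (m k : ℕ) : rising a (m + k) = rising a m * rising (a + m) k := by
  simp only [rising, Finset.prod_range_add]
  congr 1
  refine Finset.prod_congr rfl fun i _ => ?_
  push_cast
  ring

theorem ascPochhammer_smeval_eq_rising (a : ℝ) (k : ℕ) :
    (ascPochhammer ℕ k).smeval a = rising a k := by
  induction k with
  | zero => simp [rising]
  | succ k ih =>
    rw [rising_succ, ← ih, ascPochhammer_succ_right, Polynomial.smeval_mul]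
    simp [Polynomial.smeval_add, Polynomial.smeval_natCast]

theorem rchoose_sub_eq_rising (a : ℝ) (k : ℕ) :
    rchoose ((k : ℝ) - a) k = rising (1 - a) k / k.factorial := by
  unfold rchoose rising
  congr 1
  rw [← Finset.prod_range_reflect]
  refine Finset.prod_congr rfl fun i hi => ?_
  have hi' := Finset.mem_range.mp hi
  rw [Nat.sub_sub, Nat.cast_sub (by omega)]
  push_cast
  ring

theorem rchoose_natCast (N k : ℕ) : rchoose (N : ℝ) k = N.choose k := by
  rw [rchoose, ← descPochhammer_eval_eq_prod_range, descPochhammer_eval_eq_descFactorial,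
    Nat.descFactorial_eq_factorial_mul_choose]
  push_cast
  field_simp

theorem fall_natCast (N k : ℕ) : fall (N : ℝ) k = k.factorial * N.choose k := by
  rw [← rchoose_natCast, rchoose, fall]
  field_simp

theorem hasSum_rising (a y : ℝ) (hy : |y| < 1) :
    HasSum (fun k : ℕ => rising a k / k.factorial * y ^ k) ((1 - y) ^ (-a)) := by
  have h := (Real.one_div_one_sub_rpow_hasFPowerSeriesOnBall_zero a).hasSum
    (y := y) (by simpa [enorm_eq_nnnorm, ← NNReal.coe_lt_coe] using hy)
  have hy' : 0 ≤ 1 - y := by linarith [(abs_lt.mp hy).2]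
  convert! h using 1
  · funext k
    have hk := Ring.factorial_nsmul_multichoose_eq_ascPochhammer a k
    rw [ascPochhammer_smeval_eq_rising, nsmul_eq_mul] at hk
    have hc : Ring.choose (a + k - 1) k = Ring.multichoose a k := by
      rw [Ring.choose]
      congr 1
      ring
    simp [hc, ← hk]
    field_simp
  · simp [Real.rpow_neg hy']

theorem hasSum_of_linear_recurrence {d f : ℕ → ℝ} {y D : ℝ} (hy : |y| < 1) (hd : HasSum d D)
    (h0 : f 0 = d 0) (hf : ∀ k, f (k + 1) = y * f k + d (k + 1)) : HasSum f (D / (1 - y)) := by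
  have hf' : ∀ n, f n = ∑ p ∈ Finset.HasAntidiagonal.antidiagonal n, d p.1 * y ^ p.2 := by
    intro n
    induction n with
    | zero => simp [h0]
    | succ n ih =>
      rw [hf, ih, Finset.Nat.sum_antidiagonal_succ', Finset.mul_sum, add_comm]
      simp only [pow_zero, mul_one]
      congr 1
      refine Finset.sum_congr rfl fun p _ => ?_
      ring
  have hg := hasSum_geometric_of_abs_lt_one hy
  have hd' := hd.summable.norm
  have hg' := hg.summable.norm
  have hs := (summable_norm_sum_mul_antidiagonal_of_summable_norm hd' hg').of_norm
  have ht := tsum_mul_tsum_eq_tsum_sum_antidiagonal_of_summable_norm hd' hg'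
  rw [funext hf', div_eq_mul_inv, ← hd.tsum_eq, ← hg.tsum_eq, ht]
  exact hs.hasSum

theorem degHyperHExt_zero_right (lam : ℝ) (r : ℕ) : degHyperHExt lam r 0 = 0 := by
  rcases r with _ | _ | r <;> simp [degHyperHExt, degHyperH, degH]

theorem degHyperHExt_succ_succ (lam : ℝ) (hlam : lam ≠ 0) (r k : ℕ) :
    degHyperHExt lam (r + 1) (k + 1) =
      degHyperHExt lam (r + 1) k + degHyperHExt lam r (k + 1) := by
  rcases r with _ | r
  · simp only [degHyperHExt, degHyperH, degH, Finset.sum_Icc_succ_top (Nat.le_add_left 1 k),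
      Nat.add_sub_cancel, Nat.succ_ne_zero, if_false]
    congr 1
    have h : rising (-lam) (1 + k) = -lam * rising (1 - lam) k := by
      rw [rising_add, show -lam + (1 : ℕ) = 1 - lam by push_cast; ring]
      simp [rising]
    have hc : ((k + 1 : ℕ) : ℝ) - 1 - lam = k - lam := by push_cast; ring
    rw [hc, rchoose_sub_eq_rising, add_comm k 1, h, add_comm 1 k, Nat.factorial_succ]
    push_cast
    field_simp
  · simp only [degHyperHExt, degHyperH, Finset.sum_Icc_succ_top (Nat.le_add_left 1 k)]

theorem hasSum_choose_mul_degHyperHExt_zero (lam : ℝ) (hlam : lam ≠ 0) (m : ℕ) (y : ℝ)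
    (hy : |y| < 1) :
    HasSum (fun k : ℕ => (k.choose m : ℝ) *
        (degHyperHExt lam 0 k + ((0 + k - 1).choose k : ℝ) * (((1 - y) ^ lam - 1) / lam)) * y ^ k)
      (y ^ m * (1 - y) ^ (lam - m) * degHyperHExt lam 0 m) := by
  rcases Nat.eq_zero_or_pos m with rfl | hm
  · have h1 := (hasSum_rising (-lam) y hy).mul_left (-(1 / lam))
    have h2 := hasSum_ite_eq (0 : ℕ) ((1 - y) ^ lam / lam)
    convert! h1.add h2 using 1
    · funext k
      rcases k with _ | k
      · simp [degHyperHExt, rising]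
        field_simp
        ring
      · simp [degHyperHExt]
        field_simp
    · simp [degHyperHExt]
      field_simp
      ring
  · rw [← hasSum_nat_add_iff' m, Finset.sum_eq_zero (fun k hk => by
      simp [Nat.choose_eq_zero_of_lt (Finset.mem_range.mp hk)]), sub_zero]
    have h1 := (hasSum_rising (-lam + m) y hy).mul_left (y ^ m * degHyperHExt lam 0 m)
    convert! h1 using 1
    · funext k
      have hz : (0 + (k + m) - 1).choose (k + m) = 0 := Nat.choose_eq_zero_of_lt (by omega)
      have hc : ((k + m).choose m : ℝ) * k.factorial * m.factorial = (k + m).factorial := by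
        exact_mod_cast Nat.add_choose_mul_factorial_mul_factorial k m
      rw [hz]
      have hkm : k + m ≠ 0 := by omega
      rw [degHyperHExt, degHyperHExt, if_neg hkm, if_neg hm.ne']
      rw [add_comm k m, rising_add, add_comm m k, ← hc, pow_add]
      have : ((k + m).choose m : ℝ) ≠ 0 := by
        exact_mod_cast (Nat.choose_pos (Nat.le_add_left m k)).ne'
      push_cast
      field_simp
      ring
    · rw [show -(-lam + (m : ℝ)) = lam - m by ring]
      ring

theorem choose_add_sub_one_succ (r k : ℕ) :
    (r + 1 + (k + 1) - 1).choose (k + 1) =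
      (r + 1 + k - 1).choose k + (r + (k + 1) - 1).choose (k + 1) := by
  rw [show r + 1 + (k + 1) - 1 = r + k + 1 by omega, show r + 1 + k - 1 = r + k by omega,
    show r + (k + 1) - 1 = r + k by omega, Nat.choose_succ_succ]

theorem hasSum_choose_mul_degHyperHExt (lam : ℝ) (hlam : lam ≠ 0) (r m : ℕ) (y : ℝ)
    (hy : |y| < 1) :
    HasSum (fun k : ℕ => (k.choose m : ℝ) *
        (degHyperHExt lam r k + ((r + k - 1).choose k : ℝ) * (((1 - y) ^ lam - 1) / lam)) * y ^ k)
      (y ^ m * (1 - y) ^ (lam - r - m) * degHyperHExt lam r m) := by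
  have hy' : 0 < 1 - y := by linarith [(abs_lt.mp hy).2]
  induction r generalizing m with
  | zero => simpa using hasSum_choose_mul_degHyperHExt_zero lam hlam m y hy
  | succ r ihr =>
    induction m with
    | zero =>
      convert! hasSum_of_linear_recurrence hy (ihr 0) ?_ ?_ using 1
      · simp [degHyperHExt_zero_right]
      · simp [degHyperHExt_zero_right]
      · intro k
        rw [degHyperHExt_succ_succ lam hlam, choose_add_sub_one_succ]
        push_cast
        simp only [Nat.choose_zero_right]
        ring
    | succ m ihm =>
      have hshift := (hasSum_nat_add_iff' (f := fun k : ℕ => if k = 0 then (0 : ℝ) else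
        y * (((k - 1).choose m : ℝ) * (degHyperHExt lam (r + 1) (k - 1) +
          ((r + 1 + (k - 1) - 1).choose (k - 1) : ℝ) * (((1 - y) ^ lam - 1) / lam)) *
            y ^ (k - 1))) (g := y * (y ^ m * (1 - y) ^ (lam - (r + 1 : ℕ) - m) *
              degHyperHExt lam (r + 1) m)) 1).mp (by simpa using ihm.mul_left y)
      convert! hasSum_of_linear_recurrence hy ((ihr (m + 1)).add hshift) ?_ ?_ using 1
      · rw [degHyperHExt_succ_succ lam hlam, eq_div_iff hy'.ne']
        have e : (1 - y) ^ (lam - r - (m + 1 : ℕ)) =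
            (1 - y) ^ (lam - (r + 1 : ℕ) - (m + 1 : ℕ)) * (1 - y) := by
          nth_rw 3 [← Real.rpow_one (1 - y)]
          rw [← Real.rpow_add hy']
          push_cast
          ring_nf
        have e' : lam - (r + 1 : ℕ) - (m : ℝ) = lam - r - (m + 1 : ℕ) := by push_cast; ring
        rw [e', e]
        ring
      · simp
      · intro k
        rw [degHyperHExt_succ_succ lam hlam, choose_add_sub_one_succ, Nat.choose_succ_succ]
        simp only [Nat.succ_ne_zero, if_false, Nat.add_sub_cancel]
        push_cast
        ring

theorem stmt6 (lam : ℝ) (hlam : lam ≠ 0) (r n : ℕ) (hr : 1 ≤ r) (hn : 1 ≤ n) (y : ℝ)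
    (hy : |y| < 1) (S2 : ℕ → ℕ → ℝ)
    (hS2 : ∀ (m : ℕ) (z : ℝ), degFall lam z m = ∑ k ∈ Finset.range (m + 1), S2 m k * fall z k) :
    Summable (fun k : ℕ =>
      |degFall lam (k : ℝ) n *
        (degHyperH lam r k + rchoose ((r + k - 1 : ℕ) : ℝ) k * (((1 - y) ^ lam - 1) / lam)) *
          y ^ k|) ∧
    (1 / (1 - y) ^ r) * HFpolyR lam S2 r n (y / (1 - y))
      = (1 - y) ^ (-lam) *
        ∑' k : ℕ, degFall lam (k : ℝ) n *
          (degHyperH lam r k + rchoose ((r + k - 1 : ℕ) : ℝ) k * (((1 - y) ^ lam - 1) / lam)) *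
            y ^ k := by
  obtain ⟨r, rfl⟩ : ∃ s, r = s + 1 := ⟨r - 1, by omega⟩
  have hy' : 0 < 1 - y := by linarith [(abs_lt.mp hy).2]
  have key := hasSum_sum (s := Finset.range (n + 1)) fun m _ =>
    (hasSum_choose_mul_degHyperHExt lam hlam (r + 1) m y hy).mul_left (S2 n m * m.factorial)
  have hterm : (fun k : ℕ => degFall lam (k : ℝ) n *
      (degHyperH lam (r + 1) k +
        rchoose ((r + 1 + k - 1 : ℕ) : ℝ) k * (((1 - y) ^ lam - 1) / lam)) * y ^ k) =
      fun k : ℕ => ∑ m ∈ Finset.range (n + 1), S2 n m * m.factorial * ((k.choose m : ℝ) *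
        (degHyperHExt lam (r + 1) k +
          ((r + 1 + k - 1).choose k : ℝ) * (((1 - y) ^ lam - 1) / lam)) * y ^ k) := by
    funext k
    rw [hS2, Finset.sum_mul, Finset.sum_mul]
    refine Finset.sum_congr rfl fun m _ => ?_
    rw [fall_natCast, rchoose_natCast, degHyperHExt]
    ring
  rw [← hterm] at key
  refine ⟨key.summable.abs, ?_⟩
  rw [key.tsum_eq, HFpolyR, Finset.range_eq_Ico, Finset.sum_eq_sum_Ico_succ_bot (Nat.succ_pos n),
    degHyperHExt_zero_right, mul_zero, mul_zero, zero_add, Finset.mul_sum, Finset.mul_sum]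
  refine Finset.sum_congr (by ext; simp) fun m _ => ?_
  have e : (1 - y) ^ (lam - (r + 1 : ℕ) - m) =
      (1 - y) ^ lam / (1 - y) ^ (r + 1) / (1 - y) ^ m := by
    rw [Real.rpow_sub hy', Real.rpow_sub hy', Real.rpow_natCast, Real.rpow_natCast]
  rw [e, Real.rpow_neg hy'.le, degHyperHExt, div_pow]
  have := (Real.rpow_pos_of_pos hy' lam).ne'
  field_simp
end

section
/- Let λ be a nonzero real number and let k ≥ 1 be an integer. Then H_{k,λ} = (1/λ)·(1 − binom(k−λ, k)); equivalently, H_{k,λ} = (k! − ⟨1−λ⟩_k)/(λ·k!). -/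
open Finset

/-- Reversing the order of the factors: `binom(k-λ, k) = ⟨1-λ⟩_k / k!`. -/
theorem rchoose_sub_eq_rising_div (lam : ℝ) (k : ℕ) :
    rchoose ((k : ℝ) - lam) k = rising (1 - lam) k / (k.factorial : ℝ) := by
  unfold rchoose rising
  rw [← Finset.prod_range_reflect]
  congr 1
  refine Finset.prod_congr rfl fun i hi => ?_
  have hik : i + 1 ≤ k := Finset.mem_range.mp hi
  rw [Nat.sub_sub, Nat.cast_sub (by omega)]
  push_cast
  ring

theorem degH_succ (lam : ℝ) (n : ℕ) :
    degH lam (n + 1) = degH lam n + 1 / ((n : ℝ) + 1) * rchoose ((n : ℝ) - lam) n := by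
  unfold degH
  rw [Finset.sum_Icc_succ_top (by omega)]
  push_cast
  simp

theorem degH_eq_factorial_sub_rising_div (lam : ℝ) (hlam : lam ≠ 0) (k : ℕ) :
    degH lam k = ((k.factorial : ℝ) - rising (1 - lam) k) / (lam * (k.factorial : ℝ)) := by
  induction k with
  | zero => simp [degH, rising]
  | succ n ih =>
    have hf : (n.factorial : ℝ) ≠ 0 := by positivity
    have hn : (n : ℝ) + 1 ≠ 0 := by positivity
    rw [degH_succ, ih, rchoose_sub_eq_rising_div, rising_succ, Nat.factorial_succ]
    push_cast
    field_simp
    ring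

theorem stmt7 (lam : ℝ) (hlam : lam ≠ 0) (k : ℕ) (hk : 1 ≤ k) :
    degH lam k = (1 / lam) * (1 - rchoose ((k : ℝ) - lam) k) ∧
    degH lam k = ((k.factorial : ℝ) - rising (1 - lam) k) / (lam * (k.factorial : ℝ)) := by
  have hf : (k.factorial : ℝ) ≠ 0 := by positivity
  have h := degH_eq_factorial_sub_rising_div lam hlam k
  refine ⟨?_, h⟩
  rw [h, rchoose_sub_eq_rising_div]
  field_simp
end

section
/- Let λ be a nonzero real number and let k ≥ 1 be an integer. Let θ denote the operator on smooth real functions on (−1,1) given by (θg)(x) = x·g′(x), and let (θ)_{k,λ} denote the composition (θ − (k−1)λ·id) ∘ ⋯ ∘ (θ − λ·id) ∘ θ (which is independent of the order of composition). Then for g(x) = −log_λ(1−x)/(1−x) and every real x with |x| < 1, ((θ)_{k,λ} g)(x) = (1/(1−x)) · ( HF_{k,λ}(x/(1−x)) − log_λ(1−x) · F^{(1−λ)}_{k,λ}(x/(1−x)) ), where log_λ(1−x) = ((1−x)^λ − 1)/λ. -/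
open Finset

/-- Degenerate Stirling numbers of the second kind, given by their triangular recurrence. -/
noncomputable def degStirling (lam : ℝ) : ℕ → ℕ → ℝ
  | 0, 0 => 1
  | 0, _ + 1 => 0
  | k + 1, 0 => -(k : ℝ) * lam * degStirling lam k 0
  | k + 1, j + 1 =>
    degStirling lam k j + ((j : ℝ) + 1 - (k : ℝ) * lam) * degStirling lam k (j + 1)

theorem degStirling_eq_zero_of_lt (lam : ℝ) {k j : ℕ} (h : k < j) : degStirling lam k j = 0 := by
  induction k generalizing j with
  | zero =>
    obtain ⟨j, rfl⟩ := Nat.exists_eq_succ_of_ne_zero h.ne'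
    simp [degStirling]
  | succ k ih =>
    obtain ⟨j, rfl⟩ := Nat.exists_eq_succ_of_ne_zero (Nat.ne_zero_of_lt h)
    simp [degStirling, ih (show k < j by omega), ih (show k < j + 1 by omega)]

theorem sum_degStirling_succ_mul (lam : ℝ) (k : ℕ) (a : ℕ → ℝ) :
    ∑ j ∈ range (k + 2), degStirling lam (k + 1) j * a j
      = ∑ j ∈ range (k + 1), degStirling lam k j * (a (j + 1) + ((j : ℝ) - k * lam) * a j) := by
  have h : ∑ j ∈ range (k + 1), ((j : ℝ) + 1 - k * lam) * degStirling lam k (j + 1) * a (j + 1)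
        + -(k : ℝ) * lam * degStirling lam k 0 * a 0
      = ∑ j ∈ range (k + 1), ((j : ℝ) - k * lam) * degStirling lam k j * a j := by
    have h1 := sum_range_succ' (fun j : ℕ => ((j : ℝ) - k * lam) * degStirling lam k j * a j) (k + 1)
    rw [sum_range_succ, degStirling_eq_zero_of_lt lam (Nat.lt_succ_self k)] at h1
    push_cast at h1
    linear_combination -h1
  calc _ = ∑ j ∈ range (k + 1), (degStirling lam k j * a (j + 1)
          + ((j : ℝ) + 1 - k * lam) * degStirling lam k (j + 1) * a (j + 1))
        + -(k : ℝ) * lam * degStirling lam k 0 * a 0 := by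
        simp only [sum_range_succ' _ (k + 1), degStirling, add_mul _ _ (a _)]
    _ = ∑ j ∈ range (k + 1), (degStirling lam k j * a (j + 1)
          + ((j : ℝ) - k * lam) * degStirling lam k j * a j) := by
        rw [sum_add_distrib, add_assoc, h, ← sum_add_distrib]
    _ = _ := sum_congr rfl fun j _ => by ring

theorem degFall_eq_sum_degStirling (lam z : ℝ) (k : ℕ) :
    degFall lam z k = ∑ j ∈ range (k + 1), degStirling lam k j * fall z j := by
  induction k with
  | zero => simp [degFall, fall, degStirling]
  | succ k ih =>
    rw [sum_degStirling_succ_mul, degFall, prod_range_succ, ← degFall, ih, sum_mul]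
    refine sum_congr rfl fun j _ => ?_
    rw [fall, fall, prod_range_succ]
    ring

theorem fall_natCast_eq_zero {m j : ℕ} (h : m < j) : fall m j = 0 :=
  prod_eq_zero (mem_range.2 h) (sub_self _)

theorem fall_natCast_self_ne_zero (m : ℕ) : fall m m ≠ 0 :=
  prod_ne_zero_iff.2 fun _ hi =>
    sub_ne_zero.2 (Nat.cast_injective.ne (mem_range.1 hi).ne')

theorem coeff_eq_of_sum_fall_eq {n : ℕ} {b c : ℕ → ℝ}
    (h : ∀ z : ℝ, ∑ j ∈ range n, b j * fall z j = ∑ j ∈ range n, c j * fall z j) :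
    ∀ m < n, b m = c m := by
  intro m
  induction m using Nat.strong_induction_on with
  | _ m ih =>
    intro hm
    have key : ∑ j ∈ range n, (b j - c j) * fall m j = 0 := by
      simp only [sub_mul, sum_sub_distrib, h, sub_self]
    rw [sum_eq_single m] at key
    · exact sub_eq_zero.1 ((mul_eq_zero.1 key).resolve_right (fall_natCast_self_ne_zero m))
    · intro j hj hjm
      rcases lt_or_gt_of_ne hjm with h' | h'
      · rw [ih j h' (mem_range.1 hj), sub_self, zero_mul]
      · rw [fall_natCast_eq_zero h', mul_zero]
    · intro h'
      exact absurd (mem_range.2 hm) h'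

/-- `(x)_{k,λ}` applied to `θ` expands through derivatives: `(θ)_{k,λ} g = ∑ S2(k,j) x^j g^{(j)}`. -/
theorem thetaFall_eq_sum_degStirling (lam : ℝ) {s : Set ℝ} (hs : IsOpen s) {D : ℕ → ℝ → ℝ}
    (hD : ∀ j, ∀ x ∈ s, HasDerivAt (D j) (D (j + 1) x) x) {g : ℝ → ℝ}
    (hg : ∀ x ∈ s, g x = D 0 x) (k : ℕ) :
    ∀ x ∈ s, thetaFall lam k g x
      = ∑ j ∈ range (k + 1), degStirling lam k j * (x ^ j * D j x) := by
  induction k with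
  | zero => intro x hx; simp [thetaFall, degStirling, hg x hx]
  | succ k ih =>
    intro x hx
    have hder : HasDerivAt (thetaFall lam k g)
        (∑ j ∈ range (k + 1), degStirling lam k j *
          ((j : ℝ) * x ^ (j - 1) * D j x + x ^ j * D (j + 1) x)) x := by
      refine HasDerivAt.congr_of_eventuallyEq ?_ (Filter.eventually_of_mem (hs.mem_nhds hx) ih)
      exact HasDerivAt.fun_sum fun j _ => ((hasDerivAt_pow j x).mul (hD j x hx)).const_mul _
    rw [sum_degStirling_succ_mul lam k (fun j => x ^ j * D j x), thetaFall]
    beta_reduce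
    rw [hder.deriv, ih x hx, mul_sum, mul_sum, ← sum_sub_distrib]
    refine sum_congr rfl fun j _ => ?_
    cases j with
    | zero => simp; ring
    | succ j => simp only [Nat.add_sub_cancel]; push_cast; ring

theorem rchoose_natCast_sub (lam : ℝ) (j : ℕ) :
    rchoose ((j : ℝ) - lam) j = rising (1 - lam) j / (j.factorial : ℝ) := by
  rw [rchoose, rising, ← prod_range_reflect]
  congr 1
  refine prod_congr rfl fun i hi => ?_
  have hi' : i + 1 ≤ j := mem_range.1 hi
  rw [show j - 1 - i = j - (i + 1) by omega, Nat.cast_sub hi']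
  push_cast
  ring

theorem lam_mul_degH_mul_factorial (lam : ℝ) (j : ℕ) :
    lam * (degH lam j * (j.factorial : ℝ)) = (j.factorial : ℝ) - rising (1 - lam) j := by
  induction j with
  | zero => simp [degH, rising]
  | succ j ih =>
    have hj : (j.factorial : ℝ) ≠ 0 := Nat.cast_ne_zero.2 j.factorial_ne_zero
    have hj1 : (j : ℝ) + 1 ≠ 0 := by positivity
    have hH : degH lam (j + 1)
        = degH lam j + 1 / ((j : ℝ) + 1) * (rising (1 - lam) j / (j.factorial : ℝ)) := by
      rw [degH, sum_Icc_succ_top (by omega), ← degH, Nat.add_sub_cancel, ← rchoose_natCast_sub]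
      push_cast
      rw [add_sub_cancel_right]
    have hR : rising (1 - lam) (j + 1) = rising (1 - lam) j * (1 - lam + j) := prod_range_succ _ _
    rw [hH, hR, Nat.factorial_succ]
    push_cast
    field_simp
    linear_combination ((j : ℝ) + 1) * ih

theorem hasDerivAt_one_sub_rpow (p : ℝ) {x : ℝ} (hx : x < 1) :
    HasDerivAt (fun t : ℝ => (1 - t) ^ p) (-p * (1 - x) ^ (p - 1)) x := by
  have h := ((hasDerivAt_id x).const_sub 1).rpow_const (p := p) (Or.inl (sub_pos.2 hx).ne')
  simpa using h

/-- The `j`-th derivative of `-log_λ(1-x)/(1-x)` on `x < 1`. -/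
noncomputable def logQuotDeriv (lam : ℝ) (j : ℕ) (x : ℝ) : ℝ :=
  ((j.factorial : ℝ) * (1 - x) ^ (-1 - (j : ℝ))
    - rising (1 - lam) j * (1 - x) ^ (lam - 1 - (j : ℝ))) / lam

theorem hasDerivAt_logQuotDeriv (lam : ℝ) (j : ℕ) {x : ℝ} (hx : x < 1) :
    HasDerivAt (logQuotDeriv lam j) (logQuotDeriv lam (j + 1) x) x := by
  have h := (((hasDerivAt_one_sub_rpow (-1 - (j : ℝ)) hx).const_mul (j.factorial : ℝ)).sub
    ((hasDerivAt_one_sub_rpow (lam - 1 - (j : ℝ)) hx).const_mul (rising (1 - lam) j))).div_const lam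
  refine HasDerivAt.congr_deriv (f := logQuotDeriv lam j) h ?_
  have hR : rising (1 - lam) (j + 1) = rising (1 - lam) j * (1 - lam + j) := prod_range_succ _ _
  rw [logQuotDeriv, hR, Nat.factorial_succ]
  push_cast
  rw [← sub_sub, ← sub_sub]
  ring

theorem logQuotDeriv_eq {lam : ℝ} (hlam : lam ≠ 0) (j : ℕ) {x : ℝ} (hx : x < 1) :
    logQuotDeriv lam j x = 1 / (1 - x) * (degH lam j * (j.factorial : ℝ)
      - ((1 - x) ^ lam - 1) / lam * rising (1 - lam) j) / (1 - x) ^ j := by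
  have hu : 0 < 1 - x := sub_pos.2 hx
  have h1 : (1 - x) ^ (-1 - (j : ℝ)) = 1 / (1 - x) / (1 - x) ^ j := by
    rw [Real.rpow_sub hu, Real.rpow_neg_one, Real.rpow_natCast, one_div]
  have h2 : (1 - x) ^ (lam - 1 - (j : ℝ)) = (1 - x) ^ lam / (1 - x) / (1 - x) ^ j := by
    rw [Real.rpow_sub hu, Real.rpow_sub hu, Real.rpow_one, Real.rpow_natCast]
  have hH := lam_mul_degH_mul_factorial lam j
  rw [logQuotDeriv, h1, h2]
  field_simp
  linear_combination -hH

theorem stmt11 (lam : ℝ) (hlam : lam ≠ 0) (k : ℕ) (hk : 1 ≤ k)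
    (S2 : ℕ → ℕ → ℝ)
    (hS2 : ∀ (m : ℕ) (z : ℝ), degFall lam z m = ∑ j ∈ Finset.range (m + 1), S2 m j * fall z j) :
    ∀ x : ℝ, |x| < 1 →
      thetaFall lam k (fun t : ℝ => -(((1 - t) ^ lam - 1) / lam) / (1 - t)) x
        = (1 / (1 - x)) *
            (HFpoly lam S2 k (x / (1 - x))
              - (((1 - x) ^ lam - 1) / lam) * Fpoly lam S2 k (x / (1 - x))) := by
  intro x hx
  have hx1 : x < 1 := (abs_lt.1 hx).2
  have hS : ∀ j < k + 1, S2 k j = degStirling lam k j :=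
    coeff_eq_of_sum_fall_eq fun z => by rw [← hS2, degFall_eq_sum_degStirling]
  have hg : ∀ t ∈ Set.Iio (1 : ℝ),
      -(((1 - t) ^ lam - 1) / lam) / (1 - t) = logQuotDeriv lam 0 t := by
    intro t ht
    rw [logQuotDeriv_eq hlam 0 ht]
    simp [degH, rising]
    ring
  have hHF : HFpoly lam S2 k (x / (1 - x)) = ∑ j ∈ range (k + 1),
      S2 k j * degH lam j * (j.factorial : ℝ) * (x / (1 - x)) ^ j := by
    rw [HFpoly, range_eq_Ico, sum_eq_sum_Ico_succ_bot (Nat.succ_pos k)]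
    simp [degH, Finset.Ico_add_one_right_eq_Icc]
  rw [thetaFall_eq_sum_degStirling lam isOpen_Iio
    (fun j t ht => hasDerivAt_logQuotDeriv lam j ht) hg k x hx1, hHF, Fpoly, mul_sum,
    ← sum_sub_distrib, mul_sum]
  refine sum_congr rfl fun j hj => ?_
  rw [logQuotDeriv_eq hlam j hx1, hS j (mem_range.1 hj), div_pow]
  ring
end

section
/- Let λ be a nonzero real number, let r ≥ 1 be an integer, and let t be a real number with |t| < 1. Then the series Σ_{n=1}^∞ H^{(r)}_{n,λ} · t^n converges absolutely and −log_λ(1−t)/(1−t)^r = Σ_{n=1}^∞ H^{(r)}_{n,λ} · t^n, where log_λ(1−t) = ((1−t)^λ − 1)/λ. -/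
open Finset

theorem ring_choose_eq_rchoose (a : ℝ) (k : ℕ) : Ring.choose a k = rchoose a k := by
  rw [Ring.choose_eq_smul, Polynomial.descPochhammer_smeval_eq_ascPochhammer,
    Polynomial.ascPochhammer_smeval_eq_eval, ← descPochhammer_eval_eq_ascPochhammer,
    descPochhammer_eval_eq_prod_range, smul_eq_mul, rchoose, div_eq_inv_mul]

theorem rchoose_succ (lam : ℝ) (k : ℕ) :
    rchoose (k - lam) (k + 1) = -lam * (1 / ((k + 1 : ℕ) : ℝ) * rchoose (k - lam) k) := by
  have hk : ((k : ℝ) + 1) ≠ 0 := by positivity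
  have hf : (k.factorial : ℝ) ≠ 0 := by positivity
  simp only [rchoose, Finset.prod_range_succ, Nat.factorial_succ]
  push_cast
  field_simp
  ring

/-- The generating function of the increments of the degenerate harmonic numbers is
`-log_λ (1 - t)`. -/
theorem hasSum_neg_degLog {lam : ℝ} (hlam : lam ≠ 0) {t : ℝ} (ht : |t| < 1) :
    HasSum (fun n : ℕ => (1 / (n : ℝ) * rchoose ((n : ℝ) - 1 - lam) (n - 1)) * t ^ n)
      (-(((1 - t) ^ lam - 1) / lam)) := by
  have hpos : 0 ≤ 1 - t := by linarith [le_abs_self t]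
  have hmem : t ∈ Metric.eball (0 : ℝ) 1 := by
    simpa [enorm_eq_nnnorm, ← NNReal.coe_lt_coe] using ht
  have h := (Real.one_div_one_sub_rpow_hasFPowerSeriesOnBall_zero (-lam)).hasSum hmem
  simp only [FormalMultilinearSeries.ofScalars_apply_eq, ring_choose_eq_rchoose, zero_add,
    smul_eq_mul, Real.rpow_neg hpos, one_div, inv_inv] at h
  rw [← hasSum_nat_add_iff' 1] at h ⊢
  convert! h.mul_left (-lam⁻¹) using 1
  · funext n
    have key := rchoose_succ lam n
    have e : -lam + ((n + 1 : ℕ) : ℝ) - 1 = n - lam := by push_cast; ring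
    have e' : ((n + 1 : ℕ) : ℝ) - 1 - lam = n - lam := by push_cast; ring
    rw [e, e', key, Nat.add_sub_cancel]
    field_simp
  · simp [rchoose]
    field_simp

/-- Multiplying a power series by `1 / (1 - t)` replaces its coefficients by partial sums. -/
theorem HasSum.sum_range_succ_mul_pow {a : ℕ → ℝ} {t A : ℝ} (ht : |t| < 1)
    (h : HasSum (fun n => a n * t ^ n) A) :
    HasSum (fun n => (∑ k ∈ Finset.range (n + 1), a k) * t ^ n) (A / (1 - t)) := by
  have hg := hasSum_geometric_of_abs_lt_one ht
  have H := hasSum_sum_range_mul_of_summable_norm h.summable.norm hg.summable.norm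
  rw [h.tsum_eq, hg.tsum_eq, ← div_eq_mul_inv] at H
  convert! H using 2 with n
  rw [Finset.sum_mul]
  refine Finset.sum_congr rfl fun k hk => ?_
  rw [mul_assoc, ← pow_add, Nat.add_sub_cancel' (Finset.mem_range_succ_iff.mp hk)]

theorem sum_Icc_one_eq_sum_range_succ {a : ℕ → ℝ} (ha : a 0 = 0) (n : ℕ) :
    ∑ k ∈ Finset.Icc 1 n, a k = ∑ k ∈ Finset.range (n + 1), a k := by
  rw [Finset.range_eq_Ico, Finset.sum_eq_sum_Ico_succ_bot (Nat.succ_pos n), ha, zero_add]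
  rfl

theorem degHyperH_zero_right (lam : ℝ) : ∀ r : ℕ, degHyperH lam r 0 = 0
  | 0 => rfl
  | 1 => by simp [degHyperH, degH]
  | r + 2 => by simp [degHyperH]

theorem hasSum_degHyperH {lam : ℝ} (hlam : lam ≠ 0) {t : ℝ} (ht : |t| < 1) (r : ℕ) :
    HasSum (fun n : ℕ => degHyperH lam (r + 1) n * t ^ n)
      (-(((1 - t) ^ lam - 1) / lam) / (1 - t) ^ (r + 1)) := by
  induction r with
  | zero =>
    simp only [degHyperH, degH, zero_add, pow_one]
    convert (hasSum_neg_degLog hlam ht).sum_range_succ_mul_pow ht using 3 with n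
    exact sum_Icc_one_eq_sum_range_succ (by simp) n
  | succ r ih =>
    rw [pow_succ, ← div_div]
    convert ih.sum_range_succ_mul_pow ht using 3 with n
    exact sum_Icc_one_eq_sum_range_succ (degHyperH_zero_right lam (r + 1)) n

theorem stmt18 (lam : ℝ) (hlam : lam ≠ 0) (r : ℕ) (hr : 1 ≤ r) (t : ℝ) (ht : |t| < 1) :
    Summable (fun n : ℕ => |degHyperH lam r n * t ^ n|) ∧
    -(((1 - t) ^ lam - 1) / lam) / (1 - t) ^ r = ∑' n : ℕ, degHyperH lam r n * t ^ n := by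
  obtain ⟨r, rfl⟩ := Nat.exists_eq_add_of_le' hr
  have h := hasSum_degHyperH hlam ht r
  exact ⟨h.summable.abs, h.tsum_eq.symm⟩
end
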